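/- Fix a prime p, an additive character ψ of ℚ_p with conductor ℤ_p, an integer c ≥ 1, and a continuous group homomorphism ω : ℤ_pˣ → ℂˣ with conductor exponent c. Let μ be a Haar measure on the additive group ℚ_p. Then ∫_{ℤ_pˣ} ω(z) ψ(p^{−c} z) dμ(z) ≠ 0. -/

import Mathlib

open MeasureTheory in
/-- The integral over `ℤ_p` of a function that only depends on the residue class mod `p ^ c`. -/
theorem Padic.setIntegral_eq_sum_of_toZModPow {p : ℕ} [Fact p.Prime]
    [MeasurableSpace ℚ_[p]] [BorelSpace ℚ_[p]] (μ : Measure ℚ_[p]) [μ.IsAddHaarMeasure]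
    (c : ℕ) (f : ℚ_[p] → ℂ) (G : ZMod (p ^ c) → ℂ)
    (hf : ∀ z : ℤ_[p], f z = G (PadicInt.toZModPow c z)) :
    ∫ z in Metric.closedBall (0 : ℚ_[p]) 1, f z ∂μ
      = μ.real (Metric.closedBall 0 ((p : ℝ) ^ (-c : ℤ))) • ∑ a, G a := by
  have hmem (a : ZMod (p ^ c)) (z : ℚ_[p]) :
      z ∈ Metric.closedBall (((a.val : ℤ_[p]) : ℚ_[p])) ((p : ℝ) ^ (-c : ℤ)) ↔
        ∃ w : ℤ_[p], (w : ℚ_[p]) = z ∧ PadicInt.toZModPow c w = a := by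
    have key (w : ℤ_[p]) : ‖w - (a.val : ℤ_[p])‖ ≤ (p : ℝ) ^ (-c : ℤ) ↔
        PadicInt.toZModPow c w = a := by
      rw [PadicInt.norm_le_pow_iff_mem_span_pow, ← PadicInt.ker_toZModPow, RingHom.mem_ker,
        map_sub, map_natCast, ZMod.natCast_zmod_val, sub_eq_zero]
    rw [mem_closedBall_iff_norm]
    constructor
    · intro h
      have h1 : ‖z - ((a.val : ℤ_[p]) : ℚ_[p])‖ ≤ 1 :=
        h.trans (zpow_le_one_of_nonpos₀ (by exact_mod_cast (Fact.out : p.Prime).one_le) (by simp))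
      let v : ℤ_[p] := ⟨_, h1⟩
      have hv : ((v + (a.val : ℤ_[p]) : ℤ_[p]) : ℚ_[p]) = z := by
        rw [PadicInt.coe_add]; exact sub_add_cancel _ _
      refine ⟨v + (a.val : ℤ_[p]), hv, (key _).1 ?_⟩
      rwa [PadicInt.norm_def, PadicInt.coe_sub, hv]
    · rintro ⟨w, rfl, hw⟩
      rw [← PadicInt.coe_sub, ← PadicInt.norm_def]
      exact (key w).2 hw
  have hcover : Metric.closedBall (0 : ℚ_[p]) 1 =
      ⋃ a : ZMod (p ^ c), Metric.closedBall (((a.val : ℤ_[p]) : ℚ_[p])) ((p : ℝ) ^ (-c : ℤ)) := by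
    ext z
    simp only [Set.mem_iUnion, hmem, mem_closedBall_zero_iff]
    exact ⟨fun h ↦ ⟨_, ⟨z, h⟩, rfl, rfl⟩, fun ⟨_, w, hw, _⟩ ↦ hw ▸ w.2⟩
  have hcongr (a : ZMod (p ^ c)) :
      Set.EqOn f (fun _ ↦ G a)
        (Metric.closedBall (((a.val : ℤ_[p]) : ℚ_[p])) ((p : ℝ) ^ (-c : ℤ))) := by
    intro z hz
    obtain ⟨w, rfl, hw⟩ := (hmem a z).1 hz
    exact (hf w).trans (congrArg G hw)
  rw [hcover, integral_iUnion_fintype (fun _ ↦ Metric.isClosed_closedBall.measurableSet),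
    Finset.smul_sum]
  · refine Finset.sum_congr rfl fun a _ ↦ ?_
    rw [setIntegral_congr_fun Metric.isClosed_closedBall.measurableSet (hcongr a),
      setIntegral_const, Measure.addHaar_real_closedBall_center]
  · intro a b hab
    refine Set.disjoint_left.2 fun z ha hb ↦ hab ?_
    obtain ⟨w, hw, rfl⟩ := (hmem a z).1 ha
    obtain ⟨w', hw', rfl⟩ := (hmem b z).1 hb
    rw [PadicInt.ext (hw.trans hw'.symm)]
  · intro a
    rw [integrableOn_congr_fun (hcongr a) Metric.isClosed_closedBall.measurableSet]
    exact integrableOn_const (isCompact_closedBall _ _).measure_lt_top.ne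

/-- The Gauss sum of a primitive Dirichlet character with respect to a primitive additive
character does not vanish. -/
theorem gaussSum_ne_zero_of_isPrimitive {N : ℕ} [NeZero N] {R : Type*} [CommRing R] [IsDomain R]
    [CharZero R] {χ : DirichletCharacter R N} (hχ : χ.IsPrimitive) {e : AddChar (ZMod N) R}
    (he : e.IsPrimitive) : gaussSum χ e ≠ 0 := by
  intro h
  have hsum : ∑ a, gaussSum χ (e.mulShift a) * e (-a) = N := by
    simp only [gaussSum, Finset.sum_mul]
    rw [Finset.sum_comm]
    have (b : ZMod N) : ∑ a, χ b * e.mulShift a b * e (-a) =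
        χ b * if b - 1 = 0 then (N : R) else 0 := by
      have := AddChar.sum_mulShift (b - 1) he
      rw [ZMod.card] at this
      push_cast at this
      rw [← this, Finset.mul_sum]
      refine Finset.sum_congr rfl fun a _ ↦ ?_
      rw [AddChar.mulShift_apply, mul_assoc, ← AddChar.map_add_eq_mul]
      ring_nf
    simp_rw [this]
    simp [sub_eq_zero]
  simp only [gaussSum_mulShift_of_isPrimitive e hχ, h, mul_zero, zero_mul,
    Finset.sum_const_zero] at hsum
  exact NeZero.ne N (by exact_mod_cast hsum.symm)

/-- An additive character of `ℚ_p` with conductor `ℤ_p` induces a primitive additive character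
of `ZMod (p ^ c)`. -/
theorem AddChar.exists_isPrimitive_toZModPow {p : ℕ} [Fact p.Prime] (ψ : AddChar ℚ_[p] ℂ)
    (htriv : ∀ x : ℚ_[p], ‖x‖ ≤ 1 → ψ x = 1) (hnontriv : ∃ x : ℚ_[p], ‖x‖ ≤ p ∧ ψ x ≠ 1)
    {c : ℕ} (hc : 1 ≤ c) :
    ∃ e : AddChar (ZMod (p ^ c)) ℂ, e.IsPrimitive ∧
      ∀ z : ℤ_[p], e (PadicInt.toZModPow c z) = ψ ((p : ℚ_[p]) ^ (-(c : ℤ)) * z) := by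
  have hp0 : (p : ℚ_[p]) ≠ 0 := by exact_mod_cast (Fact.out : p.Prime).ne_zero
  have key (k : ℕ) (z : ℤ_[p]) : ψ ((p : ℚ_[p]) ^ (-(k : ℤ)) * z) =
      ψ ((p : ℚ_[p]) ^ (-(k : ℤ))) ^ (PadicInt.toZModPow k z).val := by
    have hmem : z - ((PadicInt.toZModPow k z).val : ℤ_[p]) ∈
        (Ideal.span {(p : ℤ_[p]) ^ k} : Ideal ℤ_[p]) := by
      rw [← PadicInt.ker_toZModPow, RingHom.mem_ker, map_sub, map_natCast,
        ZMod.natCast_zmod_val, sub_self]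
    obtain ⟨w, hw⟩ := Ideal.mem_span_singleton'.1 hmem
    have hz : (p : ℚ_[p]) ^ (-(k : ℤ)) * z =
        w + (PadicInt.toZModPow k z).val • (p : ℚ_[p]) ^ (-(k : ℤ)) := by
      have hw' := congrArg (fun y : ℤ_[p] ↦ (y : ℚ_[p])) (eq_add_of_sub_eq hw.symm)
      push_cast at hw'
      rw [zpow_neg, zpow_natCast, nsmul_eq_mul, inv_mul_eq_iff_eq_mul₀ (pow_ne_zero _ hp0), hw']
      field_simp
    rw [hz, AddChar.map_add_eq_mul, htriv _ w.2, one_mul, AddChar.map_nsmul_eq_pow]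
  set ζ := ψ ((p : ℚ_[p]) ^ (-(c : ℤ))) with hζ
  have hpow (k : ℕ) : ζ ^ k = ψ (k * (p : ℚ_[p]) ^ (-(c : ℤ))) := by
    rw [hζ, ← AddChar.map_nsmul_eq_pow, nsmul_eq_mul]
  obtain ⟨m, rfl⟩ := Nat.exists_eq_add_of_le' hc
  have hprim : IsPrimitiveRoot ζ (p ^ (m + 1)) := by
    rw [IsPrimitiveRoot.iff_orderOf]
    apply orderOf_eq_prime_pow
    · rw [hpow]
      intro h
      obtain ⟨x, hx, hx1⟩ := hnontriv
      have hpx : ‖(p : ℚ_[p]) * x‖ ≤ 1 := by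
        rw [norm_mul, Padic.norm_p]
        have : (0 : ℝ) < p := by exact_mod_cast (Fact.out : p.Prime).pos
        rw [inv_mul_le_iff₀ this, mul_one]; exact hx
      apply hx1
      have := key 1 ⟨_, hpx⟩
      have h1 : (p : ℚ_[p]) ^ (-((1 : ℕ) : ℤ)) * ((p : ℚ_[p]) * x) = x := by
        simp [hp0]
      have h2 : ((p ^ m : ℕ) : ℚ_[p]) * (p : ℚ_[p]) ^ (-((m + 1 : ℕ) : ℤ)) =
          (p : ℚ_[p]) ^ (-((1 : ℕ) : ℤ)) := by
        rw [zpow_neg, zpow_neg, zpow_natCast, zpow_natCast]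
        push_cast
        field_simp
        rw [pow_succ]
      rw [h2] at h
      rw [h, one_pow] at this
      rwa [← h1]
    · rw [hpow]
      apply htriv
      rw [zpow_neg, zpow_natCast]
      push_cast
      rw [mul_inv_cancel₀ (pow_ne_zero _ hp0), norm_one]
  exact ⟨_, AddChar.zmodChar_primitive_of_primitive_root _ hprim, fun z ↦ by
    rw [AddChar.zmodChar_apply, key]⟩

/-- A character of `ℤ_pˣ` with conductor exponent `c` induces a primitive Dirichlet character
modulo `p ^ c`. -/
theorem DirichletCharacter.exists_isPrimitive_toZModPow {p : ℕ} [Fact p.Prime] {c : ℕ}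
    (hc : 1 ≤ c) (ω : ℤ_[p]ˣ →* ℂˣ)
    (htriv : ∀ z : ℤ_[p]ˣ, ‖(z : ℤ_[p]) - 1‖ ≤ (p : ℝ) ^ (-(c : ℤ)) → ω z = 1)
    (hnontriv : ∃ z : ℤ_[p]ˣ, ‖(z : ℤ_[p]) - 1‖ ≤ (p : ℝ) ^ (-((c : ℤ) - 1)) ∧ ω z ≠ 1) :
    ∃ χ : DirichletCharacter ℂ (p ^ c), χ.IsPrimitive ∧
      (∀ z : ℤ_[p]ˣ, χ (PadicInt.toZModPow c (z : ℤ_[p])) = ω z) ∧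
      ∀ z : ℤ_[p], ¬ IsUnit z → χ (PadicInt.toZModPow c z) = 0 := by
  have hp : p.Prime := Fact.out
  have hnorm (k : ℕ) (z : ℤ_[p]) :
      ‖z - 1‖ ≤ (p : ℝ) ^ (-(k : ℤ)) ↔ PadicInt.toZModPow k z = 1 := by
    rw [PadicInt.norm_le_pow_iff_mem_span_pow, ← PadicInt.ker_toZModPow, RingHom.mem_ker,
      map_sub, map_one, sub_eq_zero]
  have : Fact (1 < p ^ c) := ⟨Nat.one_lt_pow (by lia) hp.one_lt⟩
  have hsurj := ZMod.ringHom_surjective (PadicInt.toZModPow (p := p) c)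
  have : IsLocalHom (PadicInt.toZModPow (p := p) c) := hsurj.isLocalHom
  let π : ℤ_[p]ˣ →* (ZMod (p ^ c))ˣ := Units.map (PadicInt.toZModPow (p := p) c).toMonoidHom
  have hπ : Function.Surjective π := IsLocalRing.surjective_units_map_of_local_ringHom _ hsurj ‹_›
  have hker : π.ker ≤ ω.ker := fun z hz ↦ htriv z ((hnorm c z).2 (congrArg Units.val hz))
  let χ : DirichletCharacter ℂ (p ^ c) :=
    MulChar.ofUnitHom (MonoidHom.liftOfSurjective π hπ ⟨ω, hker⟩)
  have hχ (z : ℤ_[p]ˣ) : χ (PadicInt.toZModPow c (z : ℤ_[p])) = ω z := by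
    have h1 : χ (π z) = _ := MulChar.ofUnitHom_coe _ _
    have h2 := MonoidHom.liftOfRightInverse_comp_apply π _ (Function.rightInverse_surjInv hπ)
      ⟨ω, hker⟩ z
    exact h1.trans (congrArg Units.val h2)
  refine ⟨χ, ?_, hχ, fun z hz ↦ χ.map_nonunit fun h ↦ hz (isUnit_of_map_unit _ _ h)⟩
  by_contra hprim
  obtain ⟨m, rfl⟩ := Nat.exists_eq_add_of_le' hc
  have hdvd : p ^ m ∣ p ^ (m + 1) := pow_dvd_pow _ m.le_succ
  have hfac : χ.FactorsThrough (p ^ m) := by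
    have hcond := χ.conductor_dvd_level
    obtain ⟨k, hk, hk'⟩ := (Nat.dvd_prime_pow hp).1 hcond
    have hkm : k ≤ m := by
      by_contra hlt
      exact hprim (hk'.trans (by rw [show k = m + 1 by lia]))
    refine (χ.mem_conductorSet_iff_conductor_dvd hdvd).2 ?_
    rw [hk']
    exact pow_dvd_pow _ hkm
  rw [DirichletCharacter.factorsThrough_iff_ker_unitsMap hdvd] at hfac
  obtain ⟨z, hz, hz1⟩ := hnontriv
  have hz' : PadicInt.toZModPow m (z : ℤ_[p]) = 1 := by
    rw [← hnorm]; simpa using hz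
  have hmem : π z ∈ (ZMod.unitsMap hdvd).ker := by
    rw [MonoidHom.mem_ker, Units.ext_iff, ZMod.unitsMap_def, Units.coe_map, Units.val_one, ← hz',
      ← PadicInt.zmod_cast_comp_toZModPow m (m + 1) m.le_succ]
    rfl
  have h1 := congrArg Units.val (hfac hmem)
  rw [MulChar.coe_toUnitHom] at h1
  exact hz1 (Units.ext ((hχ z).symm.trans h1))


open scoped Classical in
/-- **Non-vanishing of the p-adic Gauss sum at the conductor.** Let `ψ` be an additive
character of `ℚ_p` with conductor `ℤ_p` (a continuous hom `(ℚ_p,+) → (ℂˣ of modulus 1)`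
trivial on `ℤ_p` but not on `p⁻¹ℤ_p`), and let `ω : ℤ_pˣ → ℂˣ` be a continuous character
with conductor exponent `c ≥ 1` (trivial on `1 + p^c ℤ_p`, nontrivial on `1 + p^{c-1} ℤ_p`).
For any Haar measure `μ` on `(ℚ_p, +)`, the Gauss sum
`∫_{ℤ_pˣ} ω(z) ψ(p^{-c} z) dμ(z)` is non-zero.  Here `ℤ_pˣ = {z ∈ ℚ_p : ‖z‖ = 1}` and
membership in `p^k ℤ_p` is expressed as `‖·‖ ≤ p^{-k}`. -/
theorem gauss_sum_at_conductor_ne_zero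
    (p : ℕ) [Fact p.Prime]
    [MeasurableSpace ℚ_[p]] [BorelSpace ℚ_[p]]
    (μ : MeasureTheory.Measure ℚ_[p]) [μ.IsAddHaarMeasure]
    (ψ : ℚ_[p] → ℂ)
    (hψ_cont : Continuous ψ)
    (hψ_hom : ∀ x y : ℚ_[p], ψ (x + y) = ψ x * ψ y)
    (hψ_circ : ∀ x : ℚ_[p], ‖ψ x‖ = 1)
    (hψ_triv : ∀ x : ℚ_[p], ‖x‖ ≤ 1 → ψ x = 1)
    (hψ_nontriv : ∃ x₀ : ℚ_[p], ‖x₀‖ ≤ p ∧ ψ x₀ ≠ 1)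
    (c : ℕ) (hc : 1 ≤ c)
    (ω : ℤ_[p]ˣ →* ℂˣ)
    (hω_cont : Continuous ω)
    (hω_triv : ∀ z : ℤ_[p]ˣ, ‖(z : ℤ_[p]) - 1‖ ≤ (p : ℝ) ^ (-(c : ℤ)) → ω z = 1)
    (hω_nontriv : ∃ z₀ : ℤ_[p]ˣ, ‖(z₀ : ℤ_[p]) - 1‖ ≤ (p : ℝ) ^ (-((c : ℤ) - 1)) ∧ ω z₀ ≠ 1) :
    ∫ z in {z : ℚ_[p] | ‖z‖ = 1},
      (if h : ‖z‖ = 1 then ((ω (PadicInt.mkUnits h) : ℂˣ) : ℂ) else 0)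
        * ψ ((p : ℚ_[p]) ^ (-(c : ℤ)) * z) ∂μ
      ≠ 0 := by
  let Ψ : AddChar ℚ_[p] ℂ := ⟨ψ, hψ_triv 0 (by simp), hψ_hom⟩
  obtain ⟨e, he, heψ⟩ := Ψ.exists_isPrimitive_toZModPow hψ_triv hψ_nontriv hc
  obtain ⟨χ, hχ, hχω, hχ0⟩ :=
    DirichletCharacter.exists_isPrimitive_toZModPow hc ω hω_triv hω_nontriv
  rw [← MeasureTheory.setIntegral_eq_of_subset_of_forall_sdiff_eq_zero
      (t := Metric.closedBall (0 : ℚ_[p]) 1) Metric.isClosed_closedBall.measurableSet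
      (fun z hz ↦ by rw [mem_closedBall_zero_iff]; exact le_of_eq hz)
      (fun z hz ↦ by
        have hz' : ¬ ‖z‖ = 1 := hz.2
        rw [dif_neg hz', zero_mul]),
    Padic.setIntegral_eq_sum_of_toZModPow μ c _ (fun a ↦ χ a * e a)]
  · refine smul_ne_zero ?_ (gaussSum_ne_zero_of_isPrimitive hχ he)
    have hr : (0 : ℝ) < (p : ℝ) ^ (-c : ℤ) :=
      zpow_pos (by exact_mod_cast (Fact.out : p.Prime).pos) _
    exact (ENNReal.toReal_pos (Metric.measure_closedBall_pos μ 0 hr).ne'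
      (isCompact_closedBall _ _).measure_lt_top.ne).ne'
  · intro z
    rw [heψ]
    congr 1
    split_ifs with h
    · rw [← hχω]
      rfl
    · rw [hχ0 z fun hu ↦ h (PadicInt.isUnit_iff.1 hu)]
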